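/- Let R be an associative ring (not necessarily unital) satisfying the faithfulness conditions, let n ≥ 2 and m ≥ 2, let S be any associative ring, and let φ : M_n(R) → S be a bijection such that φ(x₁·x₂⋯x_m) = φ(x₁)·φ(x₂)⋯φ(x_m) for all x₁, …, x_m ∈ M_n(R). Then φ is additive, i.e., φ(x + y) = φ(x) + φ(y) for all x, y ∈ M_n(R). -/

import Mathlib

/-- The ordered product `x 0 * x 1 * ⋯ * x m` of a nonempty tuple of elements of a
magma (no unit required). -/
def prodNE {G : Type*} [Mul G] : ∀ {m : ℕ}, (Fin (m + 1) → G) → G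
  | 0, x => x 0
  | m + 1, x => prodNE (fun i : Fin (m + 1) => x i.castSucc) * x (Fin.last (m + 1))

theorem prodNE_eq_foldl {G : Type*} [Mul G] : ∀ {m : ℕ} (t : G) (r : Fin m → G),
    prodNE (Fin.cons t r : Fin (m + 1) → G) = (List.ofFn r).foldl (· * ·) t
  | 0, _, _ => rfl
  | m + 1, t, r => by
    have h : (fun i : Fin (m + 1) => (Fin.cons t r : Fin (m + 2) → G) i.castSucc) =
        Fin.cons t fun i : Fin m => r i.castSucc := by
      funext i
      refine Fin.cases rfl (fun i => ?_) i
      rw [← Fin.succ_castSucc, Fin.cons_succ, Fin.cons_succ]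
    rw [prodNE, h, prodNE_eq_foldl, ← Fin.succ_last, Fin.cons_succ, List.ofFn_succ',
      List.concat_eq_append, List.foldl_append]
    rfl

theorem foldr_mul_cons {G : Type*} [Semigroup G] (x : G) (l : List G) (t : G) :
    (t :: l).foldr (· * ·) x = (l ++ [x]).foldl (· * ·) t := by
  induction l generalizing t with
  | nil => rfl
  | cons s l ih =>
    have := ih (t * s)
    simp only [List.foldr_cons, List.cons_append, List.foldl_cons] at this ⊢
    rw [← this, mul_assoc]

section Fold

variable {A : Type*} [NonUnitalRing A]

theorem foldl_mul_add (l : List A) (u v : A) :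
    l.foldl (· * ·) (u + v) = l.foldl (· * ·) u + l.foldl (· * ·) v := by
  induction l generalizing u v with
  | nil => rfl
  | cons s l ih => simp only [List.foldl_cons, add_mul, ih]

theorem foldl_mul_zero (l : List A) : l.foldl (· * ·) (0 : A) = 0 := by
  induction l with
  | nil => rfl
  | cons s l ih => simpa using ih

theorem foldr_mul_add (l : List A) (u v : A) :
    l.foldr (· * ·) (u + v) = l.foldr (· * ·) u + l.foldr (· * ·) v := by
  induction l with
  | nil => rfl
  | cons s l ih => simp only [List.foldr_cons, mul_add, ih]

theorem foldr_mul_zero (l : List A) : l.foldr (· * ·) (0 : A) = 0 := by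
  induction l with
  | nil => rfl
  | cons s l ih => simp [ih]

theorem eq_of_foldl_mul_eq (h : ∀ a : A, (∀ b, a * b = 0) → a = 0) (k : ℕ) {x y : A}
    (hxy : ∀ l : List A, l.length = k → l.foldl (· * ·) x = l.foldl (· * ·) y) : x = y := by
  induction k generalizing x y with
  | zero => exact hxy [] rfl
  | succ k ih =>
    refine sub_eq_zero.1 (h _ fun s => ?_)
    rw [sub_mul, sub_eq_zero]
    exact ih fun l hl => hxy (s :: l) (by simp [hl])

theorem eq_of_foldr_mul_eq (h : ∀ a : A, (∀ b, b * a = 0) → a = 0) (k : ℕ) {x y : A}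
    (hxy : ∀ l : List A, l.length = k → l.foldr (· * ·) x = l.foldr (· * ·) y) : x = y := by
  induction k generalizing x y with
  | zero => exact hxy [] rfl
  | succ k ih =>
    refine sub_eq_zero.1 (h _ fun s => ?_)
    rw [mul_sub, sub_eq_zero]
    refine ih fun l hl => ?_
    simpa using hxy (l ++ [s]) (by simp [hl])

end Fold

section Multiplicative

variable {A S : Type*} [NonUnitalRing A] [NonUnitalRing S] {m : ℕ} {φ : A → S}

theorem map_foldl_of_prodNE
    (hmul : ∀ x : Fin (m + 2) → A, φ (prodNE x) = prodNE fun i => φ (x i))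
    (l : List A) (hl : l.length = m + 1) (t : A) :
    φ (l.foldl (· * ·) t) = (l.map φ).foldl (· * ·) (φ t) := by
  obtain ⟨r, rfl⟩ : ∃ r : Fin (m + 1) → A, l = List.ofFn r :=
    ⟨fun i => l.get (i.cast hl.symm), List.ext_getElem (by simp [hl]) (by simp [-List.ofFn_succ])⟩
  have h := hmul (Fin.cons t r)
  have e : (fun i => φ ((Fin.cons t r : Fin (m + 2) → A) i)) = Fin.cons (φ t) (φ ∘ r) := by
    funext i
    exact Fin.cases rfl (fun i => rfl) i
  rwa [e, prodNE_eq_foldl, prodNE_eq_foldl, ← List.map_ofFn] at h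

theorem map_foldl_mul
    (hmul : ∀ x : Fin (m + 2) → A, φ (prodNE x) = prodNE fun i => φ (x i))
    (l : List A) (hl : l.length = m) (a s : A) :
    φ (l.foldl (· * ·) (a * s)) = (l.map φ).foldl (· * ·) (φ a * φ s) :=
  map_foldl_of_prodNE hmul (s :: l) (by simp [hl]) a

theorem map_foldr_mul
    (hmul : ∀ x : Fin (m + 2) → A, φ (prodNE x) = prodNE fun i => φ (x i))
    (l : List A) (hl : l.length = m) (s a : A) :
    φ (l.foldr (· * ·) (s * a)) = (l.map φ).foldr (· * ·) (φ s * φ a) := by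
  suffices h : φ ((l ++ [s]).foldr (· * ·) a) = ((l ++ [s]).map φ).foldr (· * ·) (φ a) by
    simpa using h
  have hlen : (l ++ [s]).length = m + 1 := by simp [hl]
  generalize l ++ [s] = r at hlen
  rcases r with _ | ⟨t, r⟩
  · simp at hlen
  · rw [foldr_mul_cons, List.map_cons, foldr_mul_cons,
      map_foldl_of_prodNE hmul (r ++ [a]) (by simpa using hlen), List.map_append]
    rfl

theorem map_zero_of_prodNE (hφ : Function.Surjective φ)
    (hmul : ∀ x : Fin (m + 2) → A, φ (prodNE x) = prodNE fun i => φ (x i)) : φ 0 = 0 := by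
  obtain ⟨a, ha⟩ := hφ 0
  have h := map_foldl_mul hmul (List.replicate m 0) (by simp) a 0
  rwa [mul_zero, foldl_mul_zero, ha, zero_mul, foldl_mul_zero] at h

/-- It suffices to check additivity after multiplying on the right by a factor taken from a set
`P` with zero left annihilator, followed by `m` arbitrary factors. -/
theorem map_add_of_foldl (hφ : Function.Bijective φ)
    (hmul : ∀ x : Fin (m + 2) → A, φ (prodNE x) = prodNE fun i => φ (x i))
    {P : Set A} (hP : ∀ a : A, (∀ s ∈ P, a * s = 0) → a = 0) {a b : A}
    (hab : ∀ s ∈ P, ∀ l : List A, l.length = m →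
      φ (l.foldl (· * ·) ((a + b) * s)) =
        φ (l.foldl (· * ·) (a * s)) + φ (l.foldl (· * ·) (b * s))) :
    φ (a + b) = φ a + φ b := by
  obtain ⟨x, hx⟩ := hφ.2 (φ a + φ b)
  rw [← hx]
  congr 1
  refine (sub_eq_zero.1 (hP _ fun s hs => ?_)).symm
  rw [sub_mul, sub_eq_zero]
  refine eq_of_foldl_mul_eq (fun a ha => hP a fun s _ => ha s) m fun l hl => hφ.1 ?_
  rw [hab s hs l hl]
  simp only [map_foldl_mul hmul l hl, hx, add_mul, foldl_mul_add]

/-- It suffices to check additivity after multiplying on the left by a factor taken from a set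
`P` with zero right annihilator, preceded by `m` arbitrary factors. -/
theorem map_add_of_foldr (hφ : Function.Bijective φ)
    (hmul : ∀ x : Fin (m + 2) → A, φ (prodNE x) = prodNE fun i => φ (x i))
    {P : Set A} (hP : ∀ a : A, (∀ s ∈ P, s * a = 0) → a = 0) {a b : A}
    (hab : ∀ s ∈ P, ∀ l : List A, l.length = m →
      φ (l.foldr (· * ·) (s * (a + b))) =
        φ (l.foldr (· * ·) (s * a)) + φ (l.foldr (· * ·) (s * b))) :
    φ (a + b) = φ a + φ b := by
  obtain ⟨x, hx⟩ := hφ.2 (φ a + φ b)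
  rw [← hx]
  congr 1
  refine (sub_eq_zero.1 (hP _ fun s hs => ?_)).symm
  rw [mul_sub, sub_eq_zero]
  refine eq_of_foldr_mul_eq (fun a ha => hP a fun s _ => ha s) m fun l hl => hφ.1 ?_
  rw [hab s hs l hl]
  simp only [map_foldr_mul hmul l hl, hx, mul_add, foldr_mul_add]

end Multiplicative

section Matrix

variable {R S ι : Type*} [NonUnitalRing R] [NonUnitalRing S] [Fintype ι] [DecidableEq ι]

/-- The matrices with at most one nonzero entry. -/
def singleEntry (R ι : Type*) [NonUnitalRing R] [DecidableEq ι] : Set (Matrix ι ι R) :=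
  {s | ∃ p q c, s = Matrix.single p q c}

theorem mul_single_apply' (a : Matrix ι ι R) (p q : ι) (c : R) (i j : ι) :
    (a * Matrix.single p q c) i j = if q = j then a i p * c else 0 := by
  simp [Matrix.mul_apply, Matrix.single_apply, ite_and]

theorem single_mul_apply' (a : Matrix ι ι R) (p q : ι) (c : R) (i j : ι) :
    (Matrix.single p q c * a) i j = if p = i then c * a q j else 0 := by
  simp [Matrix.mul_apply, Matrix.single_apply, ite_and]

theorem eq_zero_of_mul_single (hl : ∀ a : R, (∀ b : R, a * b = 0) → a = 0)
    (a : Matrix ι ι R) (h : ∀ s ∈ singleEntry R ι, a * s = 0) : a = 0 := by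
  ext i p
  refine hl _ fun c => ?_
  simpa [mul_single_apply'] using congr_fun₂ (h _ ⟨p, p, c, rfl⟩) i p

theorem eq_zero_of_single_mul (hr : ∀ a : R, (∀ b : R, b * a = 0) → a = 0)
    (a : Matrix ι ι R) (h : ∀ s ∈ singleEntry R ι, s * a = 0) : a = 0 := by
  ext p j
  refine hr _ fun c => ?_
  simpa [single_mul_apply'] using congr_fun₂ (h _ ⟨p, p, c, rfl⟩) p j

variable {m : ℕ} {φ : Matrix ι ι R → S}

theorem map_add_of_disjoint_cols (hl : ∀ a : R, (∀ b : R, a * b = 0) → a = 0)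
    (hφ : Function.Bijective φ)
    (hmul : ∀ x : Fin (m + 2) → Matrix ι ι R, φ (prodNE x) = prodNE fun i => φ (x i))
    {a b : Matrix ι ι R} (hab : ∀ p, (∀ i, a i p = 0) ∨ (∀ i, b i p = 0)) :
    φ (a + b) = φ a + φ b := by
  refine map_add_of_foldl hφ hmul (eq_zero_of_mul_single hl) ?_
  rintro _ ⟨p, q, c, rfl⟩ l -
  have h0 := map_zero_of_prodNE hφ.2 hmul
  rcases hab p with h | h
  · have : a * Matrix.single p q c = 0 := by ext; simp [mul_single_apply', h]
    rw [add_mul, this, zero_add, foldl_mul_zero, h0, zero_add]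
  · have : b * Matrix.single p q c = 0 := by ext; simp [mul_single_apply', h]
    rw [add_mul, this, add_zero, foldl_mul_zero, h0, add_zero]

theorem map_add_of_disjoint_rows (hr : ∀ a : R, (∀ b : R, b * a = 0) → a = 0)
    (hφ : Function.Bijective φ)
    (hmul : ∀ x : Fin (m + 2) → Matrix ι ι R, φ (prodNE x) = prodNE fun i => φ (x i))
    {a b : Matrix ι ι R} (hab : ∀ q, (∀ j, a q j = 0) ∨ (∀ j, b q j = 0)) :
    φ (a + b) = φ a + φ b := by
  refine map_add_of_foldr hφ hmul (eq_zero_of_single_mul hr) ?_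
  rintro _ ⟨p, q, c, rfl⟩ l -
  have h0 := map_zero_of_prodNE hφ.2 hmul
  rcases hab q with h | h
  · have : Matrix.single p q c * a = 0 := by ext; simp [single_mul_apply', h]
    rw [mul_add, this, zero_add, foldr_mul_zero, h0, zero_add]
  · have : Matrix.single p q c * b = 0 := by ext; simp [single_mul_apply', h]
    rw [mul_add, this, add_zero, foldr_mul_zero, h0, add_zero]

theorem map_add_of_prodNE [Nontrivial ι] (hl : ∀ a : R, (∀ b : R, a * b = 0) → a = 0)
    (hr : ∀ a : R, (∀ b : R, b * a = 0) → a = 0) (hφ : Function.Bijective φ)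
    (hmul : ∀ x : Fin (m + 2) → Matrix ι ι R, φ (prodNE x) = prodNE fun i => φ (x i))
    (x y : Matrix ι ι R) : φ (x + y) = φ x + φ y := by
  refine map_add_of_foldl hφ hmul (eq_zero_of_mul_single hl) ?_
  rintro _ ⟨j, q, c, rfl⟩ l hlen
  have h0 := map_zero_of_prodNE hφ.2 hmul
  obtain ⟨k, hk⟩ := exists_ne j
  -- Place the `j`-th columns of `x` and `y` side by side, in columns `j` and `k`.
  let u : Matrix ι ι R := Matrix.of fun i p => if p = j then x i j else 0
  let v : Matrix ι ι R := Matrix.of fun i p => if p = k then y i j else 0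
  have huj : u * Matrix.single j q c = x * Matrix.single j q c := by
    ext; simp [u, mul_single_apply']
  have huk : u * Matrix.single k q c = 0 := by
    ext; simp [u, mul_single_apply', hk]
  have hvj : v * Matrix.single j q c = 0 := by
    ext; simp [v, mul_single_apply', hk.symm]
  have hvk : v * Matrix.single k q c = y * Matrix.single j q c := by
    ext; simp [v, mul_single_apply']
  have huv : φ (u + v) = φ u + φ v := by
    refine map_add_of_disjoint_cols hl hφ hmul fun p => ?_
    by_cases hp : p = j
    · exact Or.inr fun i => by simp [v, hp, hk.symm]
    · exact Or.inl fun i => by simp [u, hp]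
  have hjk : φ (Matrix.single j q c + Matrix.single k q c) =
      φ (Matrix.single j q c) + φ (Matrix.single k q c) := by
    refine map_add_of_disjoint_rows hr hφ hmul fun p => ?_
    by_cases hp : p = j
    · exact Or.inr fun i => by simp [hp, hk]
    · exact Or.inl fun i => by simp [Ne.symm hp]
  have key : (x + y) * Matrix.single j q c =
      (u + v) * (Matrix.single j q c + Matrix.single k q c) := by
    simp only [add_mul, mul_add, huj, huk, hvj, hvk, add_zero, zero_add]
  have hzero : ∀ a s : Matrix ι ι R, a * s = 0 →
      (l.map φ).foldl (· * ·) (φ a * φ s) = 0 := fun a s h => by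
    rw [← map_foldl_mul hmul l hlen, h, foldl_mul_zero, h0]
  rw [key, map_foldl_mul hmul l hlen, huv, hjk, ← huj, ← hvk]
  simp only [add_mul, mul_add, foldl_mul_add, hzero _ _ huk, hzero _ _ hvj, add_zero, zero_add,
    map_foldl_mul hmul l hlen]

end Matrix

/-- Theorem 3.1 of Ferreira–Jabeen specialized to `M_n(R)`: for a (not necessarily unital)
ring `R` satisfying the faithfulness conditions, `n ≥ 2` and `m = m₀ + 2 ≥ 2`, every
`m`-multiplicative isomorphism `φ` from `M_n(R)` onto a ring `S` is additive. -/
theorem m_multiplicative_isomorphism_additive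
    {R S : Type*} [NonUnitalRing R] [NonUnitalRing S]
    (hl : ∀ a : R, (∀ b : R, a * b = 0) → a = 0)
    (hr : ∀ a : R, (∀ b : R, b * a = 0) → a = 0)
    (n : ℕ) (hn : 2 ≤ n) (m₀ : ℕ)
    (φ : Matrix (Fin n) (Fin n) R → S)
    (hbij : Function.Bijective φ)
    (hmul : ∀ x : Fin (m₀ + 2) → Matrix (Fin n) (Fin n) R,
      φ (prodNE x) = prodNE fun i => φ (x i)) :
    ∀ x y : Matrix (Fin n) (Fin n) R, φ (x + y) = φ x + φ y := by
  have : Nontrivial (Fin n) := Fin.nontrivial_iff_two_le.2 hn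
  exact map_add_of_prodNE hl hr hbij hmul
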